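/- Let P, Q be orthogonal projections on a complex Hilbert space H with ‖P - Q‖ < 1, A := I + P(Q - P)P, and T := Q A^{-1/2} P. Then TT* = Q. -/

import Mathlib

theorem stmt_10 (H : Type*) [NormedAddCommGroup H] [InnerProductSpace ℂ H] [CompleteSpace H]
    (P Q : H →L[ℂ] H)
    (hP : IsIdempotentElem P) (hP' : IsSelfAdjoint P)
    (hQ : IsIdempotentElem Q) (hQ' : IsSelfAdjoint Q)
    (h : ‖P - Q‖ < 1) :
    (Q * Ring.inverse (CFC.sqrt (1 + P * (Q - P) * P)) * P) *
      star (Q * Ring.inverse (CFC.sqrt (1 + P * (Q - P) * P)) * P) = Q := by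
  have hPP : P * P = P := hP
  have hQQ : Q * Q = Q := hQ
  have hPn : ‖P‖ ≤ 1 := IsStarProjection.norm_le P ⟨hP, hP'⟩
  set A := 1 + P * (Q - P) * P with hA
  have hA0 : 0 ≤ A := by
    have e : A = star (1 - P) * (1 - P) + star (Q * P) * (Q * P) := by
      rw [star_mul, star_sub, star_one, hP'.star_eq, hQ'.star_eq, hA]
      have : P * Q * (Q * P) = P * (Q * Q) * P := by noncomm_ring
      rw [this, hQQ]
      have : P * (Q - P) * P = P * Q * P - P * P * P := by noncomm_ring
      rw [this, hPP, hPP]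
      have : (1 - P) * (1 - P) = 1 - P - P + P * P := by noncomm_ring
      rw [this, hPP]; abel
    rw [e]; exact add_nonneg (star_mul_self_nonneg _) (star_mul_self_nonneg _)
  have hAu : IsUnit A := by
    have : A = 1 - P * (P - Q) * P := by rw [hA]; noncomm_ring
    rw [this]
    apply isUnit_one_sub_of_norm_lt_one
    calc ‖P * (P - Q) * P‖ ≤ ‖P‖ * ‖P - Q‖ * ‖P‖ := norm_mul₃_le
      _ ≤ 1 * ‖P - Q‖ * 1 := by gcongr
      _ < 1 := by simpa using h
  have hSS : CFC.sqrt A * CFC.sqrt A = A := CFC.sqrt_mul_sqrt_self A hA0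
  have hSsa : IsSelfAdjoint (CFC.sqrt A) := (CFC.sqrt_nonneg A).isSelfAdjoint
  have hPA : Commute P A := by
    have e1 : P * A = P + (P * P) * (Q - P) * P := by rw [hA]; noncomm_ring
    have e2 : A * P = P + P * (Q - P) * (P * P) := by rw [hA]; noncomm_ring
    show P * A = A * P
    rw [e1, e2, hPP]
  have hPS : Commute P (CFC.sqrt A) := by
    rw [CFC.sqrt_eq_cfc]; exact (hPA.symm.cfc_nnreal NNReal.sqrt).symm
  have hSu : IsUnit (CFC.sqrt A) := by
    have : IsUnit (CFC.sqrt A * CFC.sqrt A) := by rw [hSS]; exact hAu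
    exact ((Commute.refl (CFC.sqrt A)).isUnit_mul_iff.1 this).1
  set S := CFC.sqrt A
  set B := Ring.inverse S with hB
  have hBsa : star B = B := by rw [hB, ← Ring.inverse_star, hSsa.star_eq]
  have hBS : B * S = 1 := Ring.inverse_mul_cancel S hSu
  have hSB : S * B = 1 := Ring.mul_inverse_cancel S hSu
  have hPB : P * B = B * P := by
    calc P * B = B * S * P * B := by rw [hBS, one_mul]
      _ = B * (P * S) * B := by rw [hPS.eq]; noncomm_ring
      _ = B * P * (S * B) := by noncomm_ring
      _ = B * P := by rw [hSB, mul_one]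
  set C := 1 - (P - Q) * (P - Q) with hC
  have hCe : C = 1 - P - Q + P * Q + Q * P := by
    have : C = 1 - P * P - Q * Q + P * Q + Q * P := by rw [hC]; noncomm_ring
    rw [this, hPP, hQQ]
  have hCu : IsUnit C := by
    apply isUnit_one_sub_of_norm_lt_one
    refine (norm_mul_le _ _).trans_lt ?_
    nlinarith [norm_nonneg (P - Q)]
  obtain ⟨D, hDC, hCD⟩ : ∃ D, D * C = 1 ∧ C * D = 1 :=
    ⟨_, Ring.inverse_mul_cancel C hCu, Ring.mul_inverse_cancel C hCu⟩
  have hCP : C * P = A * P := by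
    have e1 : C * P = P - P * P - Q * P + P * Q * P + Q * (P * P) := by rw [hCe]; noncomm_ring
    have e2 : A * P = P + P * Q * (P * P) - P * P * (P * P) := by rw [hA]; noncomm_ring
    rw [e1, e2, hPP, hPP]; abel
  have hPC : P * C = C * P := by
    have e1 : C * P = P - P * P - Q * P + P * Q * P + Q * (P * P) := by rw [hCe]; noncomm_ring
    have e2 : P * C = P - P * P - P * Q + (P * P) * Q + P * Q * P := by rw [hCe]; noncomm_ring
    rw [e1, e2, hPP]; abel
  have hCQ : C * Q = Q * P * Q := by
    have e1 : C * Q = Q - P * Q - Q * Q + P * (Q * Q) + Q * P * Q := by rw [hCe]; noncomm_ring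
    rw [e1, hQQ]; abel
  have hQC : Q * C = Q * P * Q := by
    have e1 : Q * C = Q - Q * P - Q * Q + Q * P * Q + (Q * Q) * P := by rw [hCe]; noncomm_ring
    rw [e1, hQQ]; abel
  have hBBA : B * B * A = 1 := by
    rw [← hSS]
    calc B * B * (S * S) = B * (B * S) * S := by noncomm_ring
      _ = 1 := by rw [hBS, mul_one, hBS]
  have hBBP : B * B * P = P * D := by
    calc B * B * P = B * B * (P * (C * D)) := by rw [hCD, mul_one]
      _ = B * B * (P * C) * D := by noncomm_ring
      _ = (B * B * A) * P * D := by rw [hPC, hCP]; noncomm_ring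
      _ = P * D := by rw [hBBA, one_mul]
  have hDQ : D * Q = Q * D := by
    calc D * Q = D * (Q * C) * D := by rw [mul_assoc, mul_assoc, hCD, mul_one]
      _ = (D * C) * Q * D := by rw [hQC, ← hCQ]; noncomm_ring
      _ = Q * D := by rw [hDC, one_mul]
  calc Q * B * P * star (Q * B * P) = Q * B * (P * P) * B * Q := by
        rw [star_mul, star_mul, hP'.star_eq, hQ'.star_eq, hBsa]; noncomm_ring
    _ = Q * B * (P * B) * Q := by rw [hPP]; noncomm_ring
    _ = Q * (B * B * P) * Q := by rw [hPB]; noncomm_ring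
    _ = Q * P * (D * Q) := by rw [hBBP]; noncomm_ring
    _ = Q * C * D := by rw [hDQ, hQC]; noncomm_ring
    _ = Q := by rw [mul_assoc, hCD, mul_one]
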